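/- Let (X,d) be a nonempty compact metric space, α ∈ (0,1], and f : X → X a continuous map whose nonwandering set decomposes as Ω(f) = J ∪ A, where J is a nonempty compact set with f(J) ⊆ J, A is a nonempty finite union of f-periodic orbits disjoint from J, and p denotes the maximum period of the orbits constituting A. Set τ := min{dist(J,A), Δ(A)} > 0. Let φ ∈ C^α(X,ℝ), write φ̄ := φ − Q(f,φ), and suppose there exist L_J ≥ 0 and v : J → ℝ with ⌈v⌉_{α,J} ≤ L_J·⌈φ⌉_α and φ̄(z) + v(z) − v(f(z)) ≤ 0 for all z ∈ J. Then there exists u : Ω(f) → ℝ with φ̄(z) + u(z) − u(f(z)) ≤ 0 for all z ∈ Ω(f) and ⌈u⌉_{α,Ω(f)} ≤ max{L_J, (2p + L_J)·τ^{−α}·(diam X)^α}·⌈φ⌉_α. -/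

import Mathlib

open MeasureTheory Set

section Defs

variable {X : Type*} [MetricSpace X]

/-- The nonwandering set of a self-map `f`. -/
def nonwanderingSet (f : X → X) : Set X :=
  {x | ∀ U ∈ nhds x, ∃ n : ℕ, 1 ≤ n ∧ ∃ y ∈ U, f^[n] y ∈ U}

/-- `φ` is `α`-Hölder on `S`. -/
def IsHolderOn (α : ℝ) (S : Set X) (φ : X → ℝ) : Prop :=
  ∃ C : ℝ, ∀ x ∈ S, ∀ y ∈ S, |φ x - φ y| ≤ C * dist x y ^ α

/-- Pointwise `α`-Hölder bound with constant `C` on `S`; equivalently the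
`α`-Hölder seminorm of `φ` on `S` is at most `C`. -/
def HolderBoundOn (C α : ℝ) (S : Set X) (φ : X → ℝ) : Prop :=
  ∀ x ∈ S, ∀ y ∈ S, |φ x - φ y| ≤ C * dist x y ^ α

/-- The `α`-Hölder seminorm of `φ` on `S`. -/
noncomputable def holderSemiOn (α : ℝ) (S : Set X) (φ : X → ℝ) : ℝ :=
  sInf {C : ℝ | 0 ≤ C ∧ ∀ x ∈ S, ∀ y ∈ S, |φ x - φ y| ≤ C * dist x y ^ α}

variable [MeasurableSpace X]

/-- `μ` is an `f`-invariant Borel probability measure. -/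
def IsInvProb (f : X → X) (μ : Measure X) : Prop :=
  IsProbabilityMeasure μ ∧ μ.map f = μ

/-- The maximum ergodic average `Q(f, φ)`. -/
noncomputable def maxErgAvg (f : X → X) (φ : X → ℝ) : ℝ :=
  sSup {r : ℝ | ∃ μ : Measure X, IsInvProb f μ ∧ r = ∫ x, φ x ∂μ}

end Defs

section Holder

variable {X : Type*} [MetricSpace X]

theorem IsHolderOn.holderBoundOn_holderSemiOn {α : ℝ} (hα : 0 < α) {S : Set X} {φ : X → ℝ}
    (h : IsHolderOn α S φ) : HolderBoundOn (holderSemiOn α S φ) α S φ := by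
  intro x hx y hy
  rcases eq_or_ne x y with rfl | hxy
  · simp [Real.zero_rpow hα.ne']
  have hd : 0 < dist x y ^ α := Real.rpow_pos_of_pos (dist_pos.2 hxy) α
  rw [← div_le_iff₀ hd]
  obtain ⟨C, hC⟩ := h
  refine le_csInf ⟨max C 0, le_max_right _ _, fun a ha b hb => (hC a ha b hb).trans ?_⟩
    fun K hK => (div_le_iff₀ hd).2 (hK.2 x hx y hy)
  gcongr
  exact le_max_left _ _

theorem holderSemiOn_nonneg (α : ℝ) (S : Set X) (φ : X → ℝ) : 0 ≤ holderSemiOn α S φ :=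
  Real.sInf_nonneg fun _ h => h.1

theorem IsHolderOn.continuous {α : ℝ} (hα : 0 < α) {φ : X → ℝ}
    (h : IsHolderOn α univ φ) : Continuous φ := by
  obtain ⟨C, hC⟩ := h
  refine continuous_iff_continuousAt.2 fun x => tendsto_iff_dist_tendsto_zero.2 ?_
  have hlim : Filter.Tendsto (fun y => C * dist y x ^ α) (nhds x) (nhds 0) := by
    have hc : Continuous fun y => C * dist y x ^ α :=
      continuous_const.mul ((continuous_id.dist continuous_const).rpow_const fun _ => .inr hα.le)
    simpa [Real.zero_rpow hα.ne'] using hc.tendsto x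
  exact squeeze_zero (fun _ => dist_nonneg) (fun y => hC y trivial x trivial) hlim

theorem HolderBoundOn.abs_sub_le_diam [CompactSpace X] {C α : ℝ} (hC : 0 ≤ C) (hα : 0 ≤ α)
    {S : Set X} {φ : X → ℝ} (h : HolderBoundOn C α S φ) {x y : X} (hx : x ∈ S) (hy : y ∈ S) :
    |φ x - φ y| ≤ C * Metric.diam (univ : Set X) ^ α := by
  refine (h x hx y hy).trans ?_
  gcongr
  exact Metric.dist_le_diam_of_mem isCompact_univ.isBounded trivial trivial

end Holder

section ErgodicAverage

variable {X : Type*} [MetricSpace X] [MeasurableSpace X]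

theorem exists_isInvProb_integral_eq_birkhoffAverage [BorelSpace X] {f : X → X}
    (hf : Measurable f) {x : X} {q : ℕ} (hq : 0 < q) (hx : f^[q] x = x) :
    ∃ μ : Measure X, IsInvProb f μ ∧
      ∀ φ : X → ℝ, ∫ y, φ y ∂μ = (q : ℝ)⁻¹ * birkhoffSum f φ q x := by
  have hq0 : (q : ENNReal) ≠ 0 := by exact_mod_cast hq.ne'
  refine ⟨(q : ENNReal)⁻¹ • ∑ i ∈ Finset.range q, Measure.dirac (f^[i] x), ⟨⟨?_⟩, ?_⟩, ?_⟩
  · simp [ENNReal.inv_mul_cancel hq0 (ENNReal.natCast_ne_top q)]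
  · have hshift : ∑ i ∈ Finset.range q, Measure.dirac (f^[i + 1] x) =
        ∑ i ∈ Finset.range q, Measure.dirac (f^[i] x) := by
      obtain ⟨n, rfl⟩ := Nat.exists_eq_succ_of_ne_zero hq.ne'
      rw [Finset.sum_range_succ, Finset.sum_range_succ' _ n, hx]
      simp
    rw [Measure.map_smul, Measure.map_finset_sum hf.aemeasurable, ← hshift]
    simp [Measure.map_dirac' hf, Function.iterate_succ_apply']
  · intro φ
    rw [integral_smul_measure, integral_finsetSum_measure fun i _ => ?_]
    · simp [birkhoffSum]
    · exact integrable_dirac (by simp)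

variable [CompactSpace X] [BorelSpace X]

theorem IsInvProb.abs_integral_sub_le {f : X → X} {μ : Measure X} (hμ : IsInvProb f μ)
    {φ : X → ℝ} (hφ : Continuous φ) {M : ℝ} (hM : ∀ x y, |φ x - φ y| ≤ M) (x : X) :
    |∫ y, φ y ∂μ - φ x| ≤ M := by
  have := hμ.1
  have hi : Integrable φ μ := hφ.integrable_of_hasCompactSupport (HasCompactSupport.of_compactSpace φ)
  have h := norm_integral_le_of_norm_le_const (μ := μ) (f := fun y => φ y - φ x)
    (Filter.Eventually.of_forall fun y => hM y x)
  rw [integral_sub hi (integrable_const _)] at h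
  simpa using h

theorem IsInvProb.integral_le_maxErgAvg {f : X → X} {μ : Measure X} (hμ : IsInvProb f μ)
    {φ : X → ℝ} (hφ : Continuous φ) {M : ℝ} (hM : ∀ x y, |φ x - φ y| ≤ M) :
    ∫ y, φ y ∂μ ≤ maxErgAvg f φ := by
  obtain ⟨x⟩ : Nonempty X := have := hμ.1; μ.nonempty_of_neZero
  refine le_csSup ⟨φ x + M, ?_⟩ ⟨μ, hμ, rfl⟩
  rintro _ ⟨ν, hν, rfl⟩
  linarith [(abs_le.1 (hν.abs_integral_sub_le hφ hM x)).2]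

theorem birkhoffSum_sub_maxErgAvg_nonpos {f : X → X} (hf : Measurable f) {φ : X → ℝ}
    (hφ : Continuous φ) {M : ℝ} (hM : ∀ x y, |φ x - φ y| ≤ M) {x : X} {q : ℕ} (hq : 0 < q)
    (hx : f^[q] x = x) : birkhoffSum f (fun y => φ y - maxErgAvg f φ) q x ≤ 0 := by
  obtain ⟨μ, hμ, hint⟩ := exists_isInvProb_integral_eq_birkhoffAverage hf hq hx
  have h := hμ.integral_le_maxErgAvg hφ hM
  rw [hint, inv_mul_le_iff₀ (by exact_mod_cast hq)] at h
  simpa [birkhoffSum] using h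

end ErgodicAverage

/-- The negative of the maximal Birkhoff sum of `ψ` over fewer than `p` steps. -/
noncomputable def negMaxBirkhoffSum {X : Type*} (f : X → X) (ψ : X → ℝ) {p : ℕ} (hp : 0 < p)
    (x : X) : ℝ :=
  -(Finset.range p).sup' ⟨0, Finset.mem_range.2 hp⟩ fun n => birkhoffSum f ψ n x

section NegMaxBirkhoffSum

variable {X : Type*} {f : X → X} {ψ : X → ℝ} {p : ℕ} (hp : 0 < p)

theorem negMaxBirkhoffSum_nonpos (x : X) : negMaxBirkhoffSum f ψ hp x ≤ 0 := by
  have h := Finset.le_sup' (fun n => birkhoffSum f ψ n x) (Finset.mem_range.2 hp)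
  simp only [birkhoffSum_zero] at h
  simpa [negMaxBirkhoffSum] using h

theorem neg_le_negMaxBirkhoffSum {M : ℝ} (hM0 : 0 ≤ M) (hM : ∀ x, ψ x ≤ M) (x : X) :
    -(p * M) ≤ negMaxBirkhoffSum f ψ hp x := by
  refine neg_le_neg (Finset.sup'_le _ _ fun n hn => ?_)
  calc birkhoffSum f ψ n x ≤ ∑ _k ∈ Finset.range n, M := Finset.sum_le_sum fun _ _ => hM _
    _ = n * M := by simp
    _ ≤ p * M := by
      gcongr
      exact (Finset.mem_range.1 hn).le

theorem add_negMaxBirkhoffSum_le {x : X} {q : ℕ} (hq : 0 < q) (hqp : q ≤ p) (hx : f^[q] x = x)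
    (hsum : birkhoffSum f ψ q x ≤ 0) :
    ψ x + negMaxBirkhoffSum f ψ hp x ≤ negMaxBirkhoffSum f ψ hp (f x) := by
  unfold negMaxBirkhoffSum
  set s := (Finset.range p).sup' ⟨0, Finset.mem_range.2 hp⟩ fun n => birkhoffSum f ψ n x
  have hs : ∀ n < p, birkhoffSum f ψ n x ≤ s := fun n hn =>
    Finset.le_sup' (fun n => birkhoffSum f ψ n x) (Finset.mem_range.2 hn)
  suffices h : (Finset.range p).sup' ⟨0, Finset.mem_range.2 hp⟩
      (fun n => birkhoffSum f ψ n (f x)) ≤ s - ψ x by linarith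
  refine Finset.sup'_le _ _ fun n hn => ?_
  have hn : n < p := Finset.mem_range.1 hn
  rw [le_sub_iff_add_le', ← birkhoffSum_succ']
  rcases lt_or_ge (n + 1) p with h | h
  · exact hs _ h
  · rw [show n + 1 = q + (p - q) by omega, birkhoffSum_add, hx]
    linarith [hs (p - q) (by omega)]

end NegMaxBirkhoffSum

/-- **Patching sub-actions.** If the nonwandering set of `f` splits into a
compact invariant piece `J` carrying a sub-action `v`, and a finite union `A`
of periodic orbits (of period at most `p`), at gap/distance at least `τ > 0`
from each other and from `J`, then `f` admits a sub-action `u` on the whole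
nonwandering set, with controlled Hölder seminorm. -/
theorem subaction_on_nonwandering_of_subaction_on_julia
    {X : Type*} [MetricSpace X] [CompactSpace X] [Nonempty X]
    [MeasurableSpace X] [BorelSpace X]
    (α : ℝ) (hα0 : 0 < α) (hα1 : α ≤ 1)
    (f : X → X) (hf : Continuous f)
    (J : Set X) (A : Finset X) (p : ℕ) (hp : 0 < p)
    (hΩ : nonwanderingSet f = J ∪ (↑A : Set X))
    (hJne : J.Nonempty) (hJcomp : IsCompact J) (hJinv : MapsTo f J J)
    (hAne : A.Nonempty) (hdisj : Disjoint J (↑A : Set X))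
    (hAinv : ∀ x ∈ A, f x ∈ A)
    (hAper : ∀ x ∈ A, ∃ q : ℕ, 0 < q ∧ q ≤ p ∧ f^[q] x = x)
    (τ : ℝ) (hτ : 0 < τ)
    (hτJA : ∀ x ∈ J, ∀ y ∈ A, τ ≤ dist x y)
    (hτA : ∀ x ∈ A, ∀ y ∈ A, x ≠ y → τ ≤ dist x y)
    (φ : X → ℝ) (hφ : IsHolderOn α univ φ)
    (L_J : ℝ) (hLJ : 0 ≤ L_J) (v : X → ℝ)
    (hv : HolderBoundOn (L_J * holderSemiOn α univ φ) α J v)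
    (hsub : ∀ z ∈ J, φ z - maxErgAvg f φ + v z - v (f z) ≤ 0) :
    ∃ u : X → ℝ,
      (∀ z ∈ nonwanderingSet f, φ z - maxErgAvg f φ + u z - u (f z) ≤ 0) ∧
      HolderBoundOn
        (max L_J ((2 * (p : ℝ) + L_J) * τ ^ (-α) * Metric.diam (univ : Set X) ^ α) *
          holderSemiOn α univ φ)
        α (nonwanderingSet f) u := by
  classical
  set H := holderSemiOn α univ φ
  have hH : 0 ≤ H := holderSemiOn_nonneg _ _ _
  set D := Metric.diam (univ : Set X) ^ α
  have hD : 0 ≤ D := Real.rpow_nonneg Metric.diam_nonneg _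
  have hφc : Continuous φ := hφ.continuous hα0
  have hM : ∀ x y, |φ x - φ y| ≤ H * D := fun x y =>
    (hφ.holderBoundOn_holderSemiOn hα0).abs_sub_le_diam hH hα0.le trivial trivial
  have hM0 : 0 ≤ H * D := mul_nonneg hH hD
  have hψ : ∀ x, φ x - maxErgAvg f φ ≤ H * D := fun x => by
    obtain ⟨a, ha⟩ := hAne
    obtain ⟨q, hq, -, hqa⟩ := hAper a ha
    obtain ⟨μ, hμ, -⟩ := exists_isInvProb_integral_eq_birkhoffAverage hf.measurable hq hqa
    linarith [hμ.integral_le_maxErgAvg hφc hM, (abs_le.1 (hμ.abs_integral_sub_le hφc hM x)).1]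
  obtain ⟨x₀, hx₀⟩ := hJne
  set w := negMaxBirkhoffSum f (fun x => φ x - maxErgAvg f φ) hp
  have hw : ∀ x, w x ≤ 0 := negMaxBirkhoffSum_nonpos hp
  have hw' : ∀ x, -(p * (H * D)) ≤ w x := neg_le_negMaxBirkhoffSum hp hM0 hψ
  have hpM : 0 ≤ p * (H * D) := by positivity
  have hLM : 0 ≤ L_J * (H * D) := by positivity
  have hv₀ : ∀ x ∈ J, |v x - v x₀| ≤ L_J * (H * D) := fun x hx =>
    (hv.abs_sub_le_diam (mul_nonneg hLJ hH) hα0.le hx hx₀).trans_eq (by ring)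
  have hAJ : ∀ x ∈ A, x ∉ J := fun x hx hxJ => hdisj.le_bot ⟨hxJ, hx⟩
  have hfar : ∀ x y : X, τ ≤ dist x y → ∀ t : ℝ, t ≤ (2 * p + L_J) * (H * D) →
      t ≤ max L_J ((2 * (p : ℝ) + L_J) * τ ^ (-α) * D) * H * dist x y ^ α := by
    intro x y hxy t ht
    have h1 : 1 ≤ τ ^ (-α) * dist x y ^ α := by
      rw [Real.rpow_neg hτ.le, inv_mul_eq_div, one_le_div (Real.rpow_pos_of_pos hτ _)]
      gcongr
    calc t ≤ (2 * p + L_J) * (H * D) * 1 := by rwa [mul_one]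
      _ ≤ (2 * p + L_J) * (H * D) * (τ ^ (-α) * dist x y ^ α) := by gcongr
      _ = (2 * (p : ℝ) + L_J) * τ ^ (-α) * D * H * dist x y ^ α := by ring
      _ ≤ _ := by
        gcongr
        exact le_max_right _ _
  refine ⟨fun x => if x ∈ J then v x - v x₀ else w x, ?_, ?_⟩
  · rw [hΩ]
    rintro z (hz | hz)
    · simp only [hz, hJinv hz, if_true]
      linarith [hsub z hz]
    · obtain ⟨q, hq, hqp, hqz⟩ := hAper z hz
      simp only [hAJ z hz, hAJ _ (hAinv z hz), if_false]
      linarith [add_negMaxBirkhoffSum_le hp hq hqp hqz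
        (birkhoffSum_sub_maxErgAvg_nonpos hf.measurable hφc hM hq hqz)]
  · rw [hΩ]
    rintro x (hx | hx) y (hy | hy)
    · simp only [hx, hy, if_true, sub_sub_sub_cancel_right]
      refine (hv x hx y hy).trans ?_
      gcongr
      exact le_max_left _ _
    · simp only [hx, hAJ y hy, if_true, if_false]
      refine hfar x y (hτJA x hx y hy) _ (abs_le.2 ?_)
      have := abs_le.1 (hv₀ x hx)
      constructor <;> linarith [hw y, hw' y]
    · simp only [hy, hAJ x hx, if_true, if_false]
      refine hfar x y (dist_comm x y ▸ hτJA y hy x hx) _ (abs_le.2 ?_)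
      have := abs_le.1 (hv₀ y hy)
      constructor <;> linarith [hw x, hw' x]
    · simp only [hAJ x hx, hAJ y hy, if_false]
      rcases eq_or_ne x y with rfl | hxy
      · simp [Real.zero_rpow hα0.ne']
      refine hfar x y (hτA x hx y hy hxy) _ (abs_le.2 ?_)
      constructor <;> linarith [hw x, hw' x, hw y, hw' y]
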